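/- arXiv:2302.10975 — 2 statements merged into one kernel-verified Lean document; each statement's English description precedes it below -/
import Mathlib

section
/- (Augmented log-marginal likelihood maximization.) Let P be any set, t ∈ ℝ^m, and for each θ ∈ P let Φ(θ) ∈ ℝ^{m×n} be a matrix, σ_e(θ) > 0, σ_w(θ) > 0, and g(θ) ∈ ℝ, such that Λ_p(θ) = σ_e(θ)⁻² Φ(θ)ᵀΦ(θ) + σ_w(θ)⁻² Ĩ is positive definite, where Ĩ = diag(1,…,1,0) ∈ ℝ^{n×n}. Define J(θ, w) = g(θ) + (1/(2σ_e(θ)²))‖t − Φ(θ)w‖₂² + (1/(2σ_w(θ)²)) wᵀĨw and w̄(θ) = σ_e(θ)⁻² Λ_p(θ)⁻¹ Φ(θ)ᵀ t. Then a pair (θ*, w*) ∈ P × ℝ^n is a global minimizer of J over P × ℝ^n if and only if it is a global minimizer of J over the constrained set {(θ, w) : w = w̄(θ)}. In particular, the unconstrained problem min_{θ,w} J(θ,w) and the constrained problem min_{θ,w} J(θ,w) s.t. Λ_p(θ)w = σ_e(θ)⁻²Φ(θ)ᵀt have the same optimal solutions. -/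
open Matrix

/-- Completing the square in a regularized least-squares objective around a solution `v` of the
normal equations. -/
theorem regularized_least_squares_add {ι κ : Type*} [Fintype ι] [Fintype κ]
    (A : Matrix ι κ ℝ) {D : Matrix κ κ ℝ} (hD : D.IsSymm) (a b : ℝ) (t : ι → ℝ) {v : κ → ℝ}
    (hv : (a • (Aᵀ * A) + b • D) *ᵥ v = a • (Aᵀ *ᵥ t)) (d : κ → ℝ) :
    a * ((t - A *ᵥ (v + d)) ⬝ᵥ (t - A *ᵥ (v + d))) + b * ((v + d) ⬝ᵥ (D *ᵥ (v + d))) =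
      a * ((t - A *ᵥ v) ⬝ᵥ (t - A *ᵥ v)) + b * (v ⬝ᵥ (D *ᵥ v)) +
        d ⬝ᵥ ((a • (Aᵀ * A) + b • D) *ᵥ d) := by
  have transpose_dot (x : ι → ℝ) : d ⬝ᵥ (Aᵀ *ᵥ x) = (A *ᵥ d) ⬝ᵥ x := by
    rw [dotProduct_mulVec, vecMul_transpose]
  have symm_dot : v ⬝ᵥ (D *ᵥ d) = d ⬝ᵥ (D *ᵥ v) := by
    rw [dotProduct_mulVec, ← mulVec_transpose, hD.eq, dotProduct_comm]
  have normal_dot := congrArg (d ⬝ᵥ ·) hv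
  simp only [add_mulVec, smul_mulVec, ← mulVec_mulVec, dotProduct_add, dotProduct_smul,
    transpose_dot, smul_eq_mul] at normal_dot ⊢
  simp only [mulVec_add, dotProduct_add, add_dotProduct, dotProduct_sub, sub_dotProduct,
    symm_dot, dotProduct_comm _ t, dotProduct_comm (A *ᵥ v) (A *ᵥ d)] at normal_dot ⊢
  linear_combination 2 * normal_dot

/-- Augmented log-marginal likelihood maximization (Theorem 1):
a pair `(θ*, w*)` is a global minimizer of `J` over `P × ℝⁿ` if and only if it
is a global minimizer of `J` over the constrained set `{(θ, w) : w = w̄(θ)}`. -/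
theorem augmented_lml_maximization
    (P : Type*) (m n : ℕ) (t : Fin m → ℝ)
    (Φ : P → Matrix (Fin m) (Fin (n + 1)) ℝ)
    (σe σw : P → ℝ) (g : P → ℝ)
    (hσe : ∀ θ, 0 < σe θ) (hσw : ∀ θ, 0 < σw θ)
    (Itilde : Matrix (Fin (n + 1)) (Fin (n + 1)) ℝ)
    (hI : Itilde = Matrix.diagonal (fun i => if i = Fin.last n then 0 else 1))
    (Λp : P → Matrix (Fin (n + 1)) (Fin (n + 1)) ℝ)
    (hΛ : ∀ θ, Λp θ = ((σe θ) ^ 2)⁻¹ • ((Φ θ)ᵀ * Φ θ) + ((σw θ) ^ 2)⁻¹ • Itilde)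
    (hpd : ∀ θ, (Λp θ).PosDef)
    (J : P → (Fin (n + 1) → ℝ) → ℝ)
    (hJ : ∀ θ w, J θ w = g θ
      + (1 / (2 * (σe θ) ^ 2)) * ((t - Φ θ *ᵥ w) ⬝ᵥ (t - Φ θ *ᵥ w))
      + (1 / (2 * (σw θ) ^ 2)) * (w ⬝ᵥ (Itilde *ᵥ w)))
    (wbar : P → Fin (n + 1) → ℝ)
    (hwbar : ∀ θ, wbar θ = ((σe θ) ^ 2)⁻¹ • ((Λp θ)⁻¹ *ᵥ ((Φ θ)ᵀ *ᵥ t)))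
    (θstar : P) (wstar : Fin (n + 1) → ℝ) :
    (∀ (θ : P) (w : Fin (n + 1) → ℝ), J θstar wstar ≤ J θ w) ↔
      (wstar = wbar θstar ∧ ∀ θ : P, J θstar wstar ≤ J θ (wbar θ)) := by
  have square (θ : P) (w : Fin (n + 1) → ℝ) : J θ w =
      J θ (wbar θ) + 1 / 2 * ((w - wbar θ) ⬝ᵥ (Λp θ *ᵥ (w - wbar θ))) := by
    have hD : Itilde.IsSymm := by rw [hI]; exact isSymm_diagonal _
    have normal : Λp θ *ᵥ wbar θ = ((σe θ) ^ 2)⁻¹ • ((Φ θ)ᵀ *ᵥ t) := by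
      rw [hwbar, mulVec_smul, mulVec_mulVec,
        mul_nonsing_inv _ ((isUnit_iff_isUnit_det _).1 (hpd θ).isUnit), one_mulVec]
    rw [hΛ] at normal
    have h := regularized_least_squares_add (Φ θ) hD _ _ t normal (w - wbar θ)
    rw [add_sub_cancel, ← hΛ] at h
    rw [hJ, hJ]
    simp only [one_div, mul_inv]
    linear_combination 1 / 2 * h
  have wbar_le (θ : P) (w : Fin (n + 1) → ℝ) : J θ (wbar θ) ≤ J θ w := by
    have h := (hpd θ).posSemidef.dotProduct_mulVec_nonneg (w - wbar θ)
    rw [star_trivial] at h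
    linarith [square θ w]
  refine ⟨fun h => ⟨?_, fun θ => h θ _⟩, fun h θ w => (h.2 θ).trans (wbar_le θ w)⟩
  by_contra hne
  have hpos := (hpd θstar).dotProduct_mulVec_pos (sub_ne_zero.2 hne)
  rw [star_trivial] at hpos
  linarith [square θstar wstar, h θstar (wbar θstar)]
end

section
/- (BLL affine cost, Theorem 2.) Let Φ̃ ∈ ℝ^{m×ñ} and Φ = [Φ̃, 𝟙] ∈ ℝ^{m×(ñ+1)} its augmentation by a column of ones. Let σ_e > 0, σ_w > 0, α = σ_w²/σ_e², Ĩ = diag(I_ñ, 0), and assume Λ̄_p = ΦᵀΦ + α⁻¹Ĩ is invertible; set Λ_p = σ_e⁻² Λ̄_p. For a test feature x ∈ ℝ^ñ let φ = (x, 1) ∈ ℝ^{ñ+1}, and define the affine cost c(x) = min{ ‖ν‖₂² + α‖e‖₂² : ν ∈ ℝ^m, e ∈ ℝ^ñ, Φ̃ᵀν + e = x, Σᵢ νᵢ = 1 }. Then c(x) = φᵀ(ΦᵀΦ + α⁻¹Ĩ)⁻¹φ = σ_e⁻² · φᵀΛ_p⁻¹φ; i.e., the affine cost with weighting factor γ =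 α equals σ_e⁻² times the Bayesian last layer predictive variance φᵀΛ_p⁻¹φ. -/
open Matrix

/-- Splitting off the bias coordinate: `(Φ̃ᵀν + e, ∑ ν) ⬝ w = ν ⬝ Φw + e ⬝ w̃`. -/
theorem snoc_dotProduct_of_affine_features {m n : ℕ} {A : Matrix (Fin m) (Fin n) ℝ}
    {B : Matrix (Fin m) (Fin (n + 1)) ℝ}
    (hB : ∀ i, (∀ j : Fin n, B i j.castSucc = A i j) ∧ B i (Fin.last n) = 1)
    (ν : Fin m → ℝ) (e : Fin n → ℝ) (w : Fin (n + 1) → ℝ) :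
    (Fin.snoc (Aᵀ *ᵥ ν + e) (∑ i, ν i) : Fin (n + 1) → ℝ) ⬝ᵥ w =
      ν ⬝ᵥ (B *ᵥ w) + e ⬝ᵥ (fun j => w j.castSucc) := by
  have h : (Fin.snoc (Aᵀ *ᵥ ν + e) (∑ i, ν i) : Fin (n + 1) → ℝ) =
      Bᵀ *ᵥ ν + Fin.snoc e 0 := by
    ext j
    refine Fin.lastCases ?_ (fun j => ?_) j
    · simp [mulVec, dotProduct, (hB _).2]
    · simp [mulVec, dotProduct, (hB _).1]
  rw [h, add_dotProduct, mulVec_transpose, ← dotProduct_mulVec]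
  congr 1
  simp [dotProduct, Fin.sum_univ_castSucc]

/-- Completing the square. -/
theorem dotProduct_weighted_sub {m n : ℕ} (ν y : Fin m → ℝ) (e v : Fin n → ℝ) {a : ℝ}
    (ha : a ≠ 0) :
    (ν - y) ⬝ᵥ (ν - y) + a * ((e - a⁻¹ • v) ⬝ᵥ (e - a⁻¹ • v)) =
      (ν ⬝ᵥ ν + a * (e ⬝ᵥ e)) - 2 * (ν ⬝ᵥ y + e ⬝ᵥ v) + (y ⬝ᵥ y + a⁻¹ * (v ⬝ᵥ v)) := by
  simp only [sub_dotProduct, dotProduct_sub, smul_dotProduct, dotProduct_smul, smul_eq_mul,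
    dotProduct_comm y ν, dotProduct_comm v e]
  field_simp
  ring

/-- BLL affine cost (Theorem 2): with weighting factor `γ = α = σ_w²/σₑ²`, the
affine cost `c(x) = min{‖ν‖² + α‖e‖² : Φ̃ᵀν + e = x, Σᵢνᵢ = 1}` of a test
feature `x` equals `φᵀ(ΦᵀΦ + α⁻¹Ĩ)⁻¹φ = σₑ⁻² φᵀΛ_p⁻¹φ`, i.e. `σₑ⁻²` times the
Bayesian last layer predictive variance at `φ = (x, 1)`. -/
theorem bll_affine_cost
    (m nt : ℕ) (Φt : Matrix (Fin m) (Fin nt) ℝ)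
    (Φ : Matrix (Fin m) (Fin (nt + 1)) ℝ)
    (hΦ : ∀ i, (∀ j : Fin nt, Φ i j.castSucc = Φt i j) ∧ Φ i (Fin.last nt) = 1)
    (σe σw α : ℝ) (hσe : 0 < σe) (hσw : 0 < σw) (hα : α = σw ^ 2 / σe ^ 2)
    (Itilde : Matrix (Fin (nt + 1)) (Fin (nt + 1)) ℝ)
    (hI : Itilde = Matrix.diagonal (fun i => if i = Fin.last nt then 0 else 1))
    (Λbar : Matrix (Fin (nt + 1)) (Fin (nt + 1)) ℝ)
    (hΛbar : Λbar = Φᵀ * Φ + α⁻¹ • Itilde)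
    (hinv : IsUnit Λbar.det)
    (Λp : Matrix (Fin (nt + 1)) (Fin (nt + 1)) ℝ)
    (hΛp : Λp = (σe ^ 2)⁻¹ • Λbar)
    (x : Fin nt → ℝ)
    (φ : Fin (nt + 1) → ℝ) (hφ : φ = Fin.snoc x 1) :
    IsLeast {c : ℝ | ∃ (ν : Fin m → ℝ) (e : Fin nt → ℝ),
        Φtᵀ *ᵥ ν + e = x ∧ (∑ i, ν i) = 1 ∧ c = ν ⬝ᵥ ν + α * (e ⬝ᵥ e)}
      (φ ⬝ᵥ (Λbar⁻¹ *ᵥ φ)) ∧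
    φ ⬝ᵥ (Λbar⁻¹ *ᵥ φ) = (σe ^ 2)⁻¹ * (φ ⬝ᵥ (Λp⁻¹ *ᵥ φ)) := by
  have hαpos : 0 < α := by rw [hα]; positivity
  have hs : σe ^ 2 ≠ 0 := by positivity
  constructor
  · set w := Λbar⁻¹ *ᵥ φ with hw
    set v : Fin nt → ℝ := fun j => w j.castSucc with hv
    have hΛw : Φᵀ *ᵥ (Φ *ᵥ w) + α⁻¹ • (Itilde *ᵥ w) = φ := by
      rw [mulVec_mulVec, ← smul_mulVec, ← add_mulVec, ← hΛbar, hw, mulVec_mulVec,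
        mul_nonsing_inv _ hinv, one_mulVec]
    have hfeas : Φtᵀ *ᵥ (Φ *ᵥ w) + α⁻¹ • v = x := by
      ext j
      have h := congrFun hΛw j.castSucc
      simp only [hI, hφ, Pi.add_apply, Pi.smul_apply, mulVec_diagonal, Fin.snoc_castSucc,
        Fin.castSucc_ne_last, if_false, one_mul] at h
      rw [← h]
      generalize Φ *ᵥ w = y
      simp [mulVec, dotProduct, (hΦ _).1, hv]
    have hsum : ∑ i, (Φ *ᵥ w) i = 1 := by
      have h := congrFun hΛw (Fin.last nt)
      simp only [hI, hφ, Pi.add_apply, Pi.smul_apply, mulVec_diagonal, Fin.snoc_last,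
        if_true, zero_mul, smul_zero, add_zero] at h
      rw [← h]
      generalize Φ *ᵥ w = y
      simp [mulVec, dotProduct, (hΦ _).2]
    have key : ∀ ν e, Φtᵀ *ᵥ ν + e = x → ∑ i, ν i = 1 →
        φ ⬝ᵥ w = ν ⬝ᵥ (Φ *ᵥ w) + e ⬝ᵥ v := by
      intro ν e h₁ h₂
      rw [← snoc_dotProduct_of_affine_features hΦ, h₁, h₂, hφ]
    have hval := key _ _ hfeas hsum
    rw [smul_dotProduct, smul_eq_mul] at hval
    refine ⟨⟨Φ *ᵥ w, α⁻¹ • v, hfeas, hsum, ?_⟩, ?_⟩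
    · rw [hval, smul_dotProduct, dotProduct_smul, smul_eq_mul, smul_eq_mul,
        mul_inv_cancel_left₀ hαpos.ne']
    · rintro c ⟨ν, e, h₁, h₂, rfl⟩
      have hsq := dotProduct_weighted_sub ν (Φ *ᵥ w) e v hαpos.ne'
      rw [← key ν e h₁ h₂, ← hval] at hsq
      have hν : 0 ≤ (ν - Φ *ᵥ w) ⬝ᵥ (ν - Φ *ᵥ w) :=
        Finset.sum_nonneg fun i _ => mul_self_nonneg _
      have he : 0 ≤ (e - α⁻¹ • v) ⬝ᵥ (e - α⁻¹ • v) :=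
        Finset.sum_nonneg fun i _ => mul_self_nonneg _
      linarith [mul_nonneg hαpos.le he]
  · have hinvΛp : Λp⁻¹ = σe ^ 2 • Λbar⁻¹ := by
      refine inv_eq_right_inv ?_
      rw [hΛp, smul_mul_smul_comm, mul_nonsing_inv _ hinv, inv_mul_cancel₀ hs, one_smul]
    rw [hinvΛp, smul_mulVec, dotProduct_smul, smul_eq_mul, inv_mul_cancel_left₀ hs]
end
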